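/- Fix ν = (ν₁, ν₂, ν₃) ∈ ℝ³ with ν ≠ 0, and let B = { R ∈ SO(4) : R · (‖ν‖ · I₀) · R⁻¹ = Ω_ν }. Then B is nonempty, and for every R₀ ∈ B one has B = { R₀ · U : U ∈ SO(4), U · I₀ = I₀ · U }; that is, B is a left coset of the centralizer of I₀ in SO(4). -/

import Mathlib

/-- The matrix `Ω_ν` associated to a uniform magnetic field `ν = (ν₁, ν₂, ν₃) ∈ ℝ³`. -/
def Omega (ν : Fin 3 → ℝ) : Matrix (Fin 4) (Fin 4) ℝ :=
  !![0,   -ν 0, -ν 1, -ν 2;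
     ν 0,  0,   -ν 2,  ν 1;
     ν 1,  ν 2,  0,   -ν 0;
     ν 2, -ν 1,  ν 0,  0]

/-- The standard orthogonal complex structure `I₀` on `ℝ⁴`. -/
def I0 : Matrix (Fin 4) (Fin 4) ℝ :=
  !![0, -1, 0, 0;
     1,  0, 0, 0;
     0,  0, 0, -1;
     0,  0, 1, 0]

/-- The matrix of left multiplication by the quaternion `a + b i + c j + d k`. -/
def quaternionLeftMul (a b c d : ℝ) : Matrix (Fin 4) (Fin 4) ℝ :=
  !![a, -b, -c, -d;
     b,  a, -d,  c;
     c,  d,  a, -b;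
     d, -c,  b,  a]

/-- Left multiplication by a unit quaternion is a special orthogonal map. -/
theorem quaternionLeftMul_mem_specialOrthogonalGroup {a b c d : ℝ}
    (h : a ^ 2 + b ^ 2 + c ^ 2 + d ^ 2 = 1) :
    quaternionLeftMul a b c d ∈ Matrix.specialOrthogonalGroup (Fin 4) ℝ := by
  rw [Matrix.mem_specialOrthogonalGroup_iff, Matrix.mem_orthogonalGroup_iff]
  constructor
  · ext i j
    fin_cases i <;> fin_cases j <;>
      simp [quaternionLeftMul, Matrix.mul_apply, Fin.sum_univ_four] <;>
      first | linear_combination h | ring1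
  · have hdet : (quaternionLeftMul a b c d).det = (a ^ 2 + b ^ 2 + c ^ 2 + d ^ 2) ^ 2 := by
      simp [quaternionLeftMul, Matrix.det_succ_row_zero, Fin.sum_univ_succ, Fin.succAbove]
      ring
    rw [hdet, h, one_pow]

/-- Every vector `ν` of norm `n > 0`, seen as an imaginary quaternion, is `n` times a
conjugate of `i` by a unit quaternion. -/
theorem exists_quaternionLeftMul_mul_I0 {n : ℝ} (hn : 0 < n) (ν : Fin 3 → ℝ)
    (h : n ^ 2 = ν 0 ^ 2 + ν 1 ^ 2 + ν 2 ^ 2) :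
    ∃ a b c d : ℝ, a ^ 2 + b ^ 2 + c ^ 2 + d ^ 2 = 1 ∧
      quaternionLeftMul a b c d * (n • I0) = Omega ν * quaternionLeftMul a b c d := by
  by_cases hs : 0 < n + ν 0
  · have hpos : 0 < 2 * n * (n + ν 0) := by positivity
    set s := Real.sqrt (2 * n * (n + ν 0))
    have hs0 : 0 < s := Real.sqrt_pos.2 hpos
    have hs2 : s ^ 2 = 2 * n * (n + ν 0) := Real.sq_sqrt hpos.le
    refine ⟨(n + ν 0) / s, 0, -ν 2 / s, ν 1 / s, ?_, ?_⟩
    · field_simp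
      linear_combination -hs2 - h
    · ext i j
      fin_cases i <;> fin_cases j <;>
        simp [quaternionLeftMul, I0, Omega, Matrix.mul_apply, Fin.sum_univ_four] <;>
        field_simp <;> first | ring1 | linear_combination h | linear_combination -h
  · have hν0 : ν 0 = -n := by nlinarith [sq_nonneg (ν 1), sq_nonneg (ν 2)]
    have hν1 : ν 1 = 0 := by
      rw [hν0] at h
      nlinarith [sq_nonneg (ν 1), sq_nonneg (ν 2)]
    have hν2 : ν 2 = 0 := by
      rw [hν0] at h
      nlinarith [sq_nonneg (ν 1), sq_nonneg (ν 2)]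
    refine ⟨0, 0, 1, 0, by norm_num, ?_⟩
    ext i j
    fin_cases i <;> fin_cases j <;>
      simp [quaternionLeftMul, I0, Omega, Matrix.mul_apply, Fin.sum_univ_four, hν0, hν1, hν2]

/-- For a special orthogonal `R`, conjugation by `R` is an intertwining relation. -/
theorem mul_mul_inv_eq_iff_of_mem_specialOrthogonalGroup {m : Type*} [Fintype m] [DecidableEq m]
    {R : Matrix m m ℝ} (hR : R ∈ Matrix.specialOrthogonalGroup m ℝ) (A C : Matrix m m ℝ) :
    R * A * R⁻¹ = C ↔ R * A = C * R := by
  have hdet : IsUnit R.det := by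
    rw [(Matrix.mem_specialOrthogonalGroup_iff.1 hR).2]
    exact isUnit_one
  constructor
  · rintro rfl
    rw [Matrix.nonsing_inv_mul_cancel_right _ _ hdet]
  · intro h
    rw [h, Matrix.mul_nonsing_inv_cancel_right _ _ hdet]

/-- For `ν ≠ 0`, the set `B` of special orthogonal matrices conjugating `‖ν‖ I₀` into `Ω_ν`
is nonempty and is a left coset of the centralizer of `I₀` in `SO(4)`. -/
theorem conjugating_set_is_coset (ν : Fin 3 → ℝ) (hν : ν ≠ 0) :
    let n : ℝ := Real.sqrt (ν 0 ^ 2 + ν 1 ^ 2 + ν 2 ^ 2)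
    let B : Set (Matrix (Fin 4) (Fin 4) ℝ) :=
      {R | R ∈ Matrix.specialOrthogonalGroup (Fin 4) ℝ ∧ R * (n • I0) * R⁻¹ = Omega ν}
    B.Nonempty ∧ ∀ R₀ ∈ B,
      B = {R | ∃ U ∈ Matrix.specialOrthogonalGroup (Fin 4) ℝ,
        U * I0 = I0 * U ∧ R = R₀ * U} := by
  intro n B
  have hsum : 0 < ν 0 ^ 2 + ν 1 ^ 2 + ν 2 ^ 2 := by
    by_contra hle
    apply hν
    ext i
    fin_cases i <;> simp <;> nlinarith [sq_nonneg (ν 0), sq_nonneg (ν 1), sq_nonneg (ν 2)]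
  have hn : 0 < n := Real.sqrt_pos.2 hsum
  have hB : ∀ R, R ∈ B ↔ R ∈ Matrix.specialOrthogonalGroup (Fin 4) ℝ ∧
      R * (n • I0) = Omega ν * R := fun R =>
    and_congr_right fun hR => mul_mul_inv_eq_iff_of_mem_specialOrthogonalGroup hR _ _
  constructor
  · obtain ⟨a, b, c, d, h, hq⟩ := exists_quaternionLeftMul_mul_I0 hn ν (Real.sq_sqrt hsum.le)
    exact ⟨_, (hB _).2 ⟨quaternionLeftMul_mem_specialOrthogonalGroup h, hq⟩⟩
  · intro R₀ hR₀
    obtain ⟨hR₀, hR₀c⟩ := (hB R₀).1 hR₀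
    have hO := (Matrix.mem_specialOrthogonalGroup_iff.1 hR₀).1
    have hmul : R₀ * star R₀ = 1 := (Matrix.mem_orthogonalGroup_iff _ _).1 hO
    have hmul' : star R₀ * R₀ = 1 := (Matrix.mem_orthogonalGroup_iff' _ _).1 hO
    have hstar : star R₀ ∈ Matrix.specialOrthogonalGroup (Fin 4) ℝ :=
      (star (⟨R₀, hR₀⟩ : Matrix.specialOrthogonalGroup (Fin 4) ℝ)).2
    have hstarc : star R₀ * Omega ν = n • I0 * star R₀ := by
      calc star R₀ * Omega ν = star R₀ * (Omega ν * R₀) * star R₀ := by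
            simp only [mul_assoc, hmul, mul_one]
        _ = n • I0 * star R₀ := by
            rw [← hR₀c, ← mul_assoc, hmul', one_mul]
    ext R
    rw [hB]
    constructor
    · rintro ⟨hR, hRc⟩
      refine ⟨star R₀ * R, mul_mem hstar hR, ?_, by rw [← mul_assoc, hmul, one_mul]⟩
      have hcomm : n • (star R₀ * R * I0) = n • (I0 * (star R₀ * R)) := by
        rw [← mul_smul_comm, mul_assoc, hRc, ← mul_assoc, hstarc, mul_assoc, smul_mul_assoc]
      exact smul_right_injective _ hn.ne' hcomm
    · rintro ⟨U, hU, hUc, rfl⟩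
      refine ⟨mul_mem hR₀ hU, ?_⟩
      rw [← mul_assoc, ← hR₀c, mul_assoc, mul_assoc, mul_smul_comm, hUc, smul_mul_assoc]
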